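/- arXiv:1704.08959 — 5 statements merged into one kernel-verified Lean document; each statement's English description precedes it below -/
import Mathlib

section
/- For every prime number p > 3, the equation α^4 + α^2 − Tα − 1/12 = 0 has exactly one solution α in the field F(p) of formal power series in 1/T over F_p whose valuation is positive (i.e., α lies in (1/T)·F_p[[1/T]]). -/
open PowerSeries in
theorem qur_unique {K : Type*} [Field K] (c f g : PowerSeries K)
    (hf : f = X * (f ^ 4 + f ^ 2 - c)) (hg : g = X * (g ^ 4 + g ^ 2 - c)) : f = g := by
  have h : (f - g) * (1 - X * (f ^ 3 + f ^ 2 * g + f * g ^ 2 + g ^ 3 + f + g)) = 0 := by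
    linear_combination hf - hg
  rcases mul_eq_zero.1 h with h | h
  · exact sub_eq_zero.1 h
  · have := congrArg constantCoeff h
    simp at this

open PowerSeries in
theorem qur_exists {K : Type*} [Field K] (c : PowerSeries K) :
    ∃ f : PowerSeries K, f = X * (f ^ 4 + f ^ 2 - c) := by
  let F : PowerSeries K → PowerSeries K := fun f => X * (f ^ 4 + f ^ 2 - c)
  have hF : ∀ u v : PowerSeries K, X * (u - v) ∣ F u - F v := fun u v =>
    ⟨u ^ 3 + u ^ 2 * v + u * v ^ 2 + v ^ 3 + u + v, by simp only [F]; ring⟩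
  let a : ℕ → PowerSeries K := fun n => F^[n] 0
  have ha : ∀ n, a (n + 1) = F (a n) := fun n => Function.iterate_succ_apply' F n 0
  have hstep : ∀ n, (X : PowerSeries K) ^ n ∣ a (n + 1) - a n := by
    intro n
    induction n with
    | zero => simp
    | succ n ih =>
      rw [ha (n + 1), ha n]
      refine dvd_trans ?_ (hF _ _)
      rw [pow_succ', ← ha n]
      exact mul_dvd_mul_left _ ih
  have hmono : ∀ n k, (X : PowerSeries K) ^ n ∣ a (n + k) - a n := by
    intro n k
    induction k with
    | zero => simp
    | succ k ih =>
      have h1 : (X : PowerSeries K) ^ n ∣ a (n + k + 1) - a (n + k) :=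
        (pow_dvd_pow _ (Nat.le_add_right n k)).trans (hstep (n + k))
      have := dvd_add h1 ih
      rwa [sub_add_sub_cancel] at this
  let f : PowerSeries K := PowerSeries.mk fun n => coeff n (a (n + 1))
  have hfa : ∀ n, (X : PowerSeries K) ^ n ∣ f - a n := by
    intro n
    rw [X_pow_dvd_iff]
    intro m hm
    obtain ⟨k, rfl⟩ : ∃ k, n = m + 1 + k := ⟨n - (m + 1), by omega⟩
    have := X_pow_dvd_iff.1 (hmono (m + 1) k) m (Nat.lt_succ_self m)
    rw [map_sub, sub_eq_zero] at this
    rw [map_sub, this, coeff_mk, sub_self]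
  refine ⟨f, ?_⟩
  change f = F f
  have key : ∀ n, (X : PowerSeries K) ^ n ∣ f - F f := by
    intro n
    have h1 : (X : PowerSeries K) ^ n ∣ F f - F (a n) :=
      ((hfa n).trans (Dvd.intro_left _ rfl)).trans (hF f (a n))
    have h2 := hstep n
    rw [ha] at h2
    have : f - F f = (f - a n) - (F f - F (a n)) - (F (a n) - a n) := by ring
    rw [this]
    exact dvd_sub (dvd_sub (hfa n) h1) h2
  rw [← sub_eq_zero]
  ext n
  simpa using X_pow_dvd_iff.1 (key (n + 1)) n (Nat.lt_succ_self n)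

theorem qur_iff {K : Type*} [Field K] (f : PowerSeries K) :
    ((f : LaurentSeries K) ^ 4 + (f : LaurentSeries K) ^ 2
      - HahnSeries.single (-1 : ℤ) (1 : K) * (f : LaurentSeries K)
        - (12 : LaurentSeries K)⁻¹ = 0) ↔
    f = PowerSeries.X * (f ^ 4 + f ^ 2 - PowerSeries.C (12 : K)⁻¹) := by
  have h12 : (12 : LaurentSeries K)⁻¹ = ((PowerSeries.C (12 : K)⁻¹ : PowerSeries K) : LaurentSeries K) := by
    rw [PowerSeries.coe_C, map_inv₀, map_ofNat]
  have hX : ((PowerSeries.X : PowerSeries K) : LaurentSeries K) * HahnSeries.single (-1 : ℤ) (1 : K) = 1 := by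
    rw [PowerSeries.coe_X, HahnSeries.single_mul_single]
    simp
  have hX0 : ((PowerSeries.X : PowerSeries K) : LaurentSeries K) ≠ 0 := left_ne_zero_of_mul_eq_one hX
  rw [h12, ← (HahnSeries.ofPowerSeries_injective (Γ := ℤ) (R := K)).eq_iff]
  simp only [map_mul, map_sub, map_add, map_pow]
  constructor
  · intro h
    linear_combination (-(HahnSeries.ofPowerSeries ℤ K PowerSeries.X)) * h
      - (HahnSeries.ofPowerSeries ℤ K f) * hX
  · intro h
    apply mul_left_cancel₀ hX0
    linear_combination -h - (HahnSeries.ofPowerSeries ℤ K f) * hX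

/-- For every prime `p > 3`, the equation
`α^4 + α^2 − T·α − 1/12 = 0` has exactly one solution `α` in `F(p)` of positive
valuation.  `F(p)` is modeled as the Laurent series field `(ZMod p)⸨X⸩` with
`X = 1/T`, so `T = HahnSeries.single (-1) 1`; positive valuation means all
coefficients at indices `≤ 0` vanish. Since `p > 3`, `12 ≠ 0` in `ZMod p`. -/
theorem quartic_unique_root (p : ℕ) [hp : Fact p.Prime] (hp3 : 3 < p) :
    ∃! α : LaurentSeries (ZMod p),
      (∀ n : ℤ, n ≤ 0 → α.coeff n = 0) ∧
      α ^ 4 + α ^ 2 - HahnSeries.single (-1 : ℤ) (1 : ZMod p) * α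
        - (12 : LaurentSeries (ZMod p))⁻¹ = 0 := by
  obtain ⟨f, hf⟩ := qur_exists (PowerSeries.C (12 : ZMod p)⁻¹)
  refine ⟨(f : LaurentSeries (ZMod p)), ⟨?_, (qur_iff f).2 hf⟩, ?_⟩
  · intro n hn
    rw [PowerSeries.coeff_coe]
    split_ifs with h
    · rfl
    · obtain rfl : n = 0 := by omega
      rw [hf]
      simp
  · rintro α ⟨h0, hα⟩
    have hg : ((PowerSeries.mk fun n : ℕ => α.coeff n : PowerSeries (ZMod p)) :
        LaurentSeries (ZMod p)) = α := by
      ext n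
      rw [PowerSeries.coeff_coe]
      split_ifs with h
      · exact (h0 n h.le).symm
      · rw [PowerSeries.coeff_mk, Int.natAbs_of_nonneg (by omega)]
    rw [← hg] at hα ⊢
    rw [qur_unique _ _ _ ((qur_iff _).1 hα) hf]
end

section
/- Let p > 3 be a prime with p ≡ 1 (mod 3), and let α be the unique solution in F(p) with positive valuation of α^4 + α^2 − Tα − 1/12 = 0. Then α is hyperquadratic of order 1: there exist polynomials A, B, C, D ∈ F_p[T], not all zero, such that A·α^{p+1} + B·α^{p} + C·α + D = 0. -/
/-- Reduction of powers of a root of the quartic to the basis `1, x, x², x³`. -/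
theorem pow_reduce {R Ω : Type*} [CommRing R] [CommRing Ω] (φ : R →+* Ω) (t k : R) (n : ℕ) :
    ∃ c0 c1 c2 c3 : R, ∀ x : Ω, x ^ 4 + x ^ 2 - φ t * x - φ k = 0 →
      x ^ n = φ c0 + φ c1 * x + φ c2 * x ^ 2 + φ c3 * x ^ 3 := by
  induction n with
  | zero => exact ⟨1, 0, 0, 0, fun x _ => by simp⟩
  | succ n ih =>
    obtain ⟨c0, c1, c2, c3, h⟩ := ih
    refine ⟨c3 * k, c0 + c3 * t, c1 - c3, c2, fun x hx => ?_⟩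
    rw [pow_succ, h x hx]
    simp only [map_mul, map_add, map_sub]
    linear_combination φ c3 * hx

/-- The core: cross ratios of the four roots are preserved by Frobenius. -/
theorem key {Ω : Type*} [Field Ω] (p : ℕ) [Fact p.Prime] [CharP Ω p] (hmod : p % 3 = 1)
    (a b c d k c0 c1 c2 c3 : Ω) (hk : 12 * k = 1)
    (e1 : a + b + c + d = 0) (e2 : a*b+a*c+a*d+b*c+b*d+c*d = 1)
    (e4 : a*b*c*d = -k)
    (hab : a ≠ b) (hac : a ≠ c) (had : a ≠ d) (hbc : b ≠ c) (hbd : b ≠ d) (hcd : c ≠ d)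
    (ha : a ^ p = c0 + c1 * a + c2 * a ^ 2 + c3 * a ^ 3)
    (hb : b ^ p = c0 + c1 * b + c2 * b ^ 2 + c3 * b ^ 3)
    (hc : c ^ p = c0 + c1 * c + c2 * c ^ 2 + c3 * c ^ 3)
    (hd : d ^ p = c0 + c1 * d + c2 * d ^ 2 + c3 * d ^ 3) :
    c2 ^ 2 - c3 * (c1 - c3) = 0 := by
  obtain ⟨P, hP⟩ : ∃ P, P = (a - b) * (c - d) := ⟨_, rfl⟩
  obtain ⟨S, hS⟩ : ∃ S, S = (a - c) * (d - b) := ⟨_, rfl⟩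
  have hP0 : P ≠ 0 := by rw [hP]; exact mul_ne_zero (sub_ne_zero.2 hab) (sub_ne_zero.2 hcd)
  have hd' : d = -(a+b+c) := by linear_combination e1
  have hI : P ^ 2 + P * S + S ^ 2 = 0 := by
    rw [hP, hS]
    have : 12 * (a*b*c*d) + (a*b+a*c+a*d+b*c+b*d+c*d)^2 = 0 := by
      rw [e4, e2]; linear_combination -hk
    rw [← this, hd']; ring
  have hw : (S / P) ^ 3 = 1 := by
    field_simp
    linear_combination (S - P) * hI
  have hwp : (S / P) ^ p = S / P := by
    conv_lhs => rw [← Nat.div_add_mod p 3, hmod, pow_add, pow_mul, hw]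
    simp
  have hSP : S ^ p * P = S * P ^ p := by
    rw [div_pow] at hwp
    field_simp at hwp
    linear_combination hwp
  rw [hP, hS, mul_pow, mul_pow, sub_pow_char, sub_pow_char, sub_pow_char, sub_pow_char,
    ha, hb, hc, hd] at hSP
  have hprod : (a-b)*(a-c)*(a-d)*(b-c)*(b-d)*(c-d) ≠ 0 := by
    simp only [ne_eq, mul_eq_zero, sub_eq_zero, not_or]
    tauto
  refine (mul_eq_zero.1 (?_ : (a-b)*(a-c)*(a-d)*(b-c)*(b-d)*(c-d) * _ = 0)).resolve_left hprod
  have e2' : a^2+b^2+c^2+a*b+b*c+c*a+1 = 0 := by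
    rw [hd'] at e2; linear_combination -e2
  have hh : (a-c)*(d-b)*(a-b)*(c-d) * ((c1+c2*(a+c)+c3*(a^2+a*c+c^2))*(c1+c2*(d+b)+c3*(d^2+d*b+b^2)) -
     (c1+c2*(a+b)+c3*(a^2+a*b+b^2))*(c1+c2*(c+d)+c3*(c^2+c*d+d^2))) = 0 := by
    linear_combination hSP
  subst hd'
  linear_combination -hh +
    (a-b)*(a-c)*(a-(-(a+b+c)))*(b-c)*(b-(-(a+b+c)))*(c-(-(a+b+c))) * c3^2 * e2'

theorem quartic_sep {Ω : Type*} [Field Ω] (x t k : Ω) (hk : 12 * k = 1) (ht : 27 * t^2 + 8 ≠ 0)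
    (hx : x ^ 4 + x ^ 2 - t * x - k = 0) (hx' : 4 * x ^ 3 + 2 * x - t = 0) : False := by
  have h : (6 * x^2+1)^2 = 0 := by
    linear_combination -12 * hx + 12 * x * hx' - hk
  have h6 : 6 * x^2 + 1 = 0 := pow_eq_zero_iff (two_ne_zero) |>.1 h
  apply ht
  have : t = 4 * x^3 + 2 * x := by linear_combination -hx'
  rw [this]
  linear_combination (72 * x^4 + 60 * x^2 + 8) * h6

theorem exists_roots {Ω : Type*} [Field Ω] [IsAlgClosed Ω] (a t k : Ω)
    (ha : a ^ 4 + a ^ 2 - t * a - k = 0) :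
    ∃ b c d, a + b + c + d = 0 ∧ a*b+a*c+a*d+b*c+b*d+c*d = 1 ∧
      a*b*c+a*b*d+a*c*d+b*c*d = t ∧ a*b*c*d = -k := by
  open Polynomial in
  obtain ⟨b, hb⟩ := IsAlgClosed.exists_root
    (X ^ 3 + C a * X ^ 2 + C (a^2+1) * X + C (a^3+a-t) : Polynomial Ω)
    (by
      have : (X ^ 3 + C a * X ^ 2 + C (a^2+1) * X + C (a^3+a-t) : Polynomial Ω).degree = 3 := by
        compute_degree!
      rw [this]; decide)
  open Polynomial in
  obtain ⟨c, hc⟩ := IsAlgClosed.exists_root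
    (X ^ 2 + C (a+b) * X + C (a^2+a*b+b^2+1) : Polynomial Ω)
    (by
      have : (X ^ 2 + C (a+b) * X + C (a^2+a*b+b^2+1) : Polynomial Ω).degree = 2 := by
        compute_degree!
      rw [this]; decide)
  simp [Polynomial.IsRoot] at hb hc
  refine ⟨b, c, -(a+b+c), by ring, ?_, ?_, ?_⟩
  · linear_combination -hc
  · linear_combination hb - (a + b) * hc
  · linear_combination -a * b * hc + a * hb - ha

theorem root_of {Ω : Type*} [Field Ω] (a b c d t k : Ω)
    (e1 : a + b + c + d = 0) (e2 : a*b+a*c+a*d+b*c+b*d+c*d = 1)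
    (e3 : a*b*c+a*b*d+a*c*d+b*c*d = t) (e4 : a*b*c*d = -k) :
    (a ^ 4 + a ^ 2 - t * a - k = 0) ∧ (4 * a^3+2*a-t = (a-b)*(a-c)*(a-d)) := by
  constructor
  · linear_combination a^3 * e1 - a^2 * e2 + a * e3 - e4
  · linear_combination 3*a^2 * e1 - 2*a * e2 + e3

/-- Let `p > 3` be a prime with `p ≡ 1 (mod 3)` and let `α` be the
unique solution in `F(p)` of positive valuation of `α^4 + α^2 − T·α − 1/12 = 0`.
Then `α` is hyperquadratic of order 1: there exist `A, B, C, D ∈ F_p[T]`, not all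
zero, with `A·α^(p+1) + B·α^p + C·α + D = 0`.  Here `F(p)` is the Laurent series
field `(ZMod p)⸨X⸩` with `X = 1/T`, `T = HahnSeries.single (-1) 1`; positive
valuation means all coefficients at indices `≤ 0` vanish; polynomials in `T` are
evaluated via `Polynomial.aeval` at `T`. -/
theorem quartic_root_hyperquadratic_order_one
    (p : ℕ) [hp : Fact p.Prime] (hp3 : 3 < p) (hmod : p % 3 = 1)
    (α : LaurentSeries (ZMod p))
    (hval : ∀ n : ℤ, n ≤ 0 → α.coeff n = 0)
    (heq : α ^ 4 + α ^ 2 - HahnSeries.single (-1 : ℤ) (1 : ZMod p) * α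
        - (12 : LaurentSeries (ZMod p))⁻¹ = 0) :
    ∃ A B C D : Polynomial (ZMod p),
      ¬(A = 0 ∧ B = 0 ∧ C = 0 ∧ D = 0) ∧
      Polynomial.aeval (HahnSeries.single (-1 : ℤ) (1 : ZMod p)) A * α ^ (p + 1)
        + Polynomial.aeval (HahnSeries.single (-1 : ℤ) (1 : ZMod p)) B * α ^ p
        + Polynomial.aeval (HahnSeries.single (-1 : ℤ) (1 : ZMod p)) C * α
        + Polynomial.aeval (HahnSeries.single (-1 : ℤ) (1 : ZMod p)) D = 0 := by
  set T : LaurentSeries (ZMod p) := HahnSeries.single (-1 : ℤ) (1 : ZMod p) with hT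
  have hpp : p.Prime := hp.out
  have h2 : (2 : ZMod p) ≠ 0 := by
    intro h0
    have h0' : ((2 : ℕ) : ZMod p) = 0 := by exact_mod_cast h0
    rw [ZMod.natCast_eq_zero_iff] at h0'
    have := Nat.le_of_dvd (by norm_num) h0'
    omega
  have h3 : (3 : ZMod p) ≠ 0 := by
    intro h0
    have h0' : ((3 : ℕ) : ZMod p) = 0 := by exact_mod_cast h0
    rw [ZMod.natCast_eq_zero_iff] at h0'
    have := Nat.le_of_dvd (by norm_num) h0'
    omega
  have h12 : (12 : ZMod p) ≠ 0 := by
    have : (12 : ZMod p) = 2 * 2 * 3 := by norm_num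
    rw [this]; exact mul_ne_zero (mul_ne_zero h2 h2) h3
  have h27 : (27 : ZMod p) ≠ 0 := by
    have : (27 : ZMod p) = 3 ^ 3 := by norm_num
    rw [this]; exact pow_ne_zero _ h3
  have hTT : 27 * T ^ 2 + 8 ≠ 0 := by
    intro h
    have hC : ∀ m : ℕ, (m : LaurentSeries (ZMod p)) = HahnSeries.single 0 (m : ZMod p) := by
      intro m
      exact (map_natCast (HahnSeries.C : ZMod p →+* LaurentSeries (ZMod p)) m).symm
    have e27 := hC 27
    have e8 := hC 8
    push_cast at e27 e8
    rw [e27, e8, hT, HahnSeries.single_pow, HahnSeries.single_mul_single] at h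
    have := congrArg (fun s : LaurentSeries (ZMod p) => s.coeff (-2)) h
    simp [HahnSeries.coeff_single_of_ne] at this
    exact h27 this
  let Ω := AlgebraicClosure (LaurentSeries (ZMod p))
  let ι : LaurentSeries (ZMod p) →+* Ω := algebraMap _ _
  have hι : Function.Injective ι := ι.injective
  let ψ : Polynomial (ZMod p) →+* LaurentSeries (ZMod p) :=
    (Polynomial.aeval T : Polynomial (ZMod p) →ₐ[ZMod p] LaurentSeries (ZMod p)).toRingHom
  let φ : Polynomial (ZMod p) →+* Ω := ι.comp ψ
  have : CharP Ω p := charP_of_injective_ringHom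
    (f := (φ.comp Polynomial.C : ZMod p →+* Ω)) (RingHom.injective _) p
  let k : Polynomial (ZMod p) := Polynomial.C (12⁻¹ : ZMod p)
  have hk : (12 : Polynomial (ZMod p)) * k = 1 := by
    have : (12 : Polynomial (ZMod p)) = Polynomial.C (12 : ZMod p) :=
      (map_ofNat (Polynomial.C : ZMod p →+* Polynomial (ZMod p)) 12).symm
    rw [this, ← Polynomial.C_mul, mul_inv_cancel₀ h12, Polynomial.C_1]
  have hψk : 12 * ψ k = 1 := by
    have := congrArg ψ hk
    simpa only [map_mul, map_ofNat, map_one] using this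
  have hφk : 12 * φ k = 1 := by
    have := congrArg φ hk
    simpa only [map_mul, map_ofNat, map_one] using this
  have hψk' : ψ k = (12 : LaurentSeries (ZMod p))⁻¹ := eq_inv_of_mul_eq_one_right hψk
  have hψX : ψ Polynomial.X = T := Polynomial.aeval_X T
  have heq1 : α ^ 4 + α ^ 2 - ψ Polynomial.X * α - ψ k = 0 := by rw [hψk', hψX]; exact heq
  have heq2 : (ι α) ^ 4 + (ι α) ^ 2 - φ Polynomial.X * (ι α) - φ k = 0 := by
    have := congrArg ι heq1
    simp only [map_add, map_sub, map_mul, map_pow, map_zero] at this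
    exact this
  have hTφ : 27 * (φ Polynomial.X) ^ 2 + 8 ≠ 0 := by
    intro h
    apply hTT
    apply hι
    rw [map_zero, ← h]
    simp only [map_add, map_mul, map_pow, map_ofNat, φ, RingHom.comp_apply, hψX]
  obtain ⟨c0, c1, c2, c3, hc⟩ := pow_reduce φ Polynomial.X k p
  obtain ⟨b, c, d, e1, e2, e3, e4⟩ := exists_roots (ι α) (φ Polynomial.X) (φ k) heq2
  have hα := hc _ heq2
  have hQ : φ c2 ^ 2 - φ c3 * (φ c1 - φ c3) = 0 := by
    clear_value ι ψ k
    generalize ι α = a at *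
    obtain ⟨-, fa'⟩ := root_of a b c d (φ Polynomial.X) (φ k) e1 e2 e3 e4
    obtain ⟨fb, fb'⟩ := root_of b a c d (φ Polynomial.X) (φ k) (by linear_combination e1)
      (by linear_combination e2) (by linear_combination e3) (by linear_combination e4)
    obtain ⟨fc, fc'⟩ := root_of c a b d (φ Polynomial.X) (φ k) (by linear_combination e1)
      (by linear_combination e2) (by linear_combination e3) (by linear_combination e4)
    obtain ⟨fd, -⟩ := root_of d a b c (φ Polynomial.X) (φ k) (by linear_combination e1)
      (by linear_combination e2) (by linear_combination e3) (by linear_combination e4)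
    have na := fun h => quartic_sep a _ _ hφk hTφ heq2 (fa'.trans h)
    have nb := fun h => quartic_sep b _ _ hφk hTφ fb (fb'.trans h)
    have nc := fun h => quartic_sep c _ _ hφk hTφ fc (fc'.trans h)
    refine key p hmod a b c d (φ k) (φ c0) (φ c1) (φ c2) (φ c3) hφk e1 e2 e4
      ?_ ?_ ?_ ?_ ?_ ?_ hα (hc b fb) (hc c fc) (hc d fd)
    · intro h; exact na (by rw [h]; ring)
    · intro h; exact na (by rw [h]; ring)
    · intro h; exact na (by rw [h]; ring)
    · intro h; exact nb (by rw [h]; ring)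
    · intro h; exact nb (by rw [h]; ring)
    · intro h; exact nc (by rw [h]; ring)
  have hQ1 : ψ c2 ^ 2 - ψ c3 * (ψ c1 - ψ c3) = 0 := by
    apply hι
    simp only [map_add, map_sub, map_mul, map_pow, map_zero]
    exact hQ
  have hα1 : α ^ p = ψ c0 + ψ c1 * α + ψ c2 * α ^ 2 + ψ c3 * α ^ 3 := by
    apply hι
    simp only [map_add, map_mul, map_pow]
    exact hα
  by_cases h0 : c2 = 0 ∧ c3 = 0
  · refine ⟨0, 1, -c1, -c0, fun h => one_ne_zero h.2.1, ?_⟩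
    change ψ 0 * α ^ (p + 1) + ψ 1 * α ^ p + ψ (-c1) * α + ψ (-c0) = 0
    rw [h0.1, h0.2] at hα1
    simp only [map_zero, map_one, map_neg] at hα1 ⊢
    linear_combination hα1
  · refine ⟨c3, -c2, c2 * c1 - c3 * (c0 + c3 * Polynomial.X), c2 * c0 - c3 * (c3 * k),
      fun h => h0 ⟨neg_eq_zero.1 h.2.1, h.1⟩, ?_⟩
    change ψ c3 * α ^ (p + 1) + ψ (-c2) * α ^ p
      + ψ (c2 * c1 - c3 * (c0 + c3 * Polynomial.X)) * α + ψ (c2 * c0 - c3 * (c3 * k)) = 0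
    rw [pow_succ, hα1]
    simp only [map_neg, map_sub, map_add, map_mul]
    linear_combination ψ c3 ^ 2 * heq1 - α ^ 2 * hQ1
end

section
/- Let p > 3 be a prime with p ≡ 2 (mod 3), and let α be the unique solution in F(p) with positive valuation of α^4 + α^2 − Tα − 1/12 = 0. Then α is hyperquadratic of order 2: there exist polynomials A, B, C, D ∈ F_p[T], not all zero, such that A·α^{p^2+1} + B·α^{p^2} + C·α + D = 0. -/
open Polynomial in
theorem qr_coeff_aeval (p : ℕ) [Fact p.Prime] (f : Polynomial (ZMod p)) (n : ℕ) :
    (Polynomial.aeval (HahnSeries.single (-1 : ℤ) (1 : ZMod p)) f).coeff (-(n : ℤ)) =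
      f.coeff n := by
  induction f using Polynomial.induction_on' with
  | add f g hf hg => simp [hf, hg]
  | monomial m a =>
    rw [Polynomial.aeval_monomial, HahnSeries.single_pow, one_pow,
      Subsingleton.elim (algebraMap (ZMod p) (LaurentSeries (ZMod p))) HahnSeries.C,
      HahnSeries.C_mul_eq_smul, HahnSeries.coeff_smul, HahnSeries.coeff_single,
      Polynomial.coeff_monomial]
    by_cases h : m = n
    · subst h; simp
    · have : ¬ (-(n : ℤ) = m • (-1 : ℤ)) := by
        simp; omega
      rw [if_neg this, if_neg h]; simp

theorem qr_inj (p : ℕ) [Fact p.Prime] (f : Polynomial (ZMod p))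
    (h : Polynomial.aeval (HahnSeries.single (-1 : ℤ) (1 : ZMod p)) f = 0) : f = 0 := by
  ext n
  rw [← qr_coeff_aeval, h]; simp

theorem qr_det_one {R : Type*} [CommRing R] (a b c d e f g h x3 x2 x1 x0 y3 y2 y1 y0 : R)
    (he : e = y3 * a ^ 3 + y2 * a ^ 2 + y1 * a + y0)
    (hf : f = y3 * b ^ 3 + y2 * b ^ 2 + y1 * b + y0)
    (hg : g = y3 * c ^ 3 + y2 * c ^ 2 + y1 * c + y0)
    (hh : h = y3 * d ^ 3 + y2 * d ^ 2 + y1 * d + y0)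
    (ke : a * e = x3 * a ^ 3 + x2 * a ^ 2 + x1 * a + x0)
    (kf : b * f = x3 * b ^ 3 + x2 * b ^ 2 + x1 * b + x0)
    (kg : c * g = x3 * c ^ 3 + x2 * c ^ 2 + x1 * c + x0)
    (kh : d * h = x3 * d ^ 3 + x2 * d ^ 2 + x1 * d + x0) :
    (x3 * y2 - x2 * y3) * ((a - b) * (a - c) * (a - d) * (b - c) * (b - d) * (c - d)) =
      (a - b) * (c - d) * ((e - g) * (f - h)) - (a - c) * (b - d) * ((e - f) * (g - h)) := by
  have key : ∀ E F G H : R, a * e = E → b * f = F → c * g = G → d * h = H →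
      (E * f - F * e) * (c - d) - (E * g - G * e) * (b - d) + (E * h - H * e) * (b - c)
      + (F * g - G * f) * (a - d) - (F * h - H * f) * (a - c) + (G * h - H * g) * (a - b) =
      (a - b) * (c - d) * ((e - g) * (f - h)) - (a - c) * (b - d) * ((e - f) * (g - h)) := by
    rintro E F G H rfl rfl rfl rfl; ring
  rw [← key _ _ _ _ ke kf kg kh]
  rw [he, hf, hg, hh]; ring

theorem qr_pow {R : Type*} [CommRing R] (u v : R) (h : u ^ 2 - u * v + v ^ 2 = 0) (k : ℕ) :
    v * u ^ (6 * k + 1) = u * v ^ (6 * k + 1) := by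
  have h6 : u ^ 6 = v ^ 6 := by
    linear_combination (u + v) * (u ^ 3 - v ^ 3) * h
  rw [pow_succ, pow_succ, pow_mul, pow_mul, h6]; ring

theorem qr_mod (p : ℕ) (hp : p.Prime) (hp3 : 3 < p) : ∃ k, p ^ 2 = 6 * k + 1 := by
  have h2 : p % 2 = 1 := by
    rcases hp.eq_two_or_odd with h | h <;> omega
  have h3 : p % 3 ≠ 0 := fun h => by
    have := (Nat.prime_dvd_prime_iff_eq Nat.prime_three hp).1 (Nat.dvd_of_mod_eq_zero h)
    omega
  have h6 : p % 6 = 1 ∨ p % 6 = 5 := by omega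
  have : p ^ 2 % 6 = 1 := by
    rcases h6 with h | h <;> simp [Nat.pow_mod, h]
  exact ⟨p ^ 2 / 6, by omega⟩

/-- a quartic over an algebraically closed field has four roots -/
theorem qr_roots {Ω : Type*} [Field Ω] [IsAlgClosed Ω] (t w : Ω) :
    ∃ a b c d : Ω, a + b + c + d = 0 ∧
      a * b + a * c + a * d + b * c + b * d + c * d = 1 ∧
      a * b * c + a * b * d + a * c * d + b * c * d = t ∧ a * b * c * d = -w := by
  obtain ⟨a, ha⟩ := IsAlgClosed.exists_root
    (Polynomial.X ^ 4 + Polynomial.X ^ 2 - Polynomial.C t * Polynomial.X - Polynomial.C w) (by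
      have : (Polynomial.X ^ 4 + Polynomial.X ^ 2 - Polynomial.C t * Polynomial.X
        - Polynomial.C w).degree = 4 := by compute_degree!
      rw [this]; decide)
  -- quotient x^3 + a x^2 + (a^2+1) x + (a^3 + a - t)
  obtain ⟨b, hb⟩ := IsAlgClosed.exists_root
    (Polynomial.X ^ 3 + Polynomial.C a * Polynomial.X ^ 2
      + Polynomial.C (a ^ 2 + 1) * Polynomial.X + Polynomial.C (a ^ 3 + a - t)) (by
      have : (Polynomial.X ^ 3 + Polynomial.C a * Polynomial.X ^ 2
      + Polynomial.C (a ^ 2 + 1) * Polynomial.X + Polynomial.C (a ^ 3 + a - t)).degree = 3 := by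
        compute_degree!
      rw [this]; decide)
  -- quotient x^2 + (a+b) x + (a^2+1+ab+b^2)
  obtain ⟨c, hc⟩ := IsAlgClosed.exists_root
    (Polynomial.X ^ 2 + Polynomial.C (a + b) * Polynomial.X
      + Polynomial.C (a ^ 2 + 1 + a * b + b ^ 2)) (by
      have : (Polynomial.X ^ 2 + Polynomial.C (a + b) * Polynomial.X
      + Polynomial.C (a ^ 2 + 1 + a * b + b ^ 2)).degree = 2 := by
        compute_degree!
      rw [this]; decide)
  simp only [Polynomial.IsRoot.def, Polynomial.eval_add, Polynomial.eval_sub, Polynomial.eval_mul,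
    Polynomial.eval_pow, Polynomial.eval_X, Polynomial.eval_C] at ha hb hc
  refine ⟨a, b, c, -a - b - c, by ring, ?_, ?_, ?_⟩
  · linear_combination -hc
  · linear_combination hb - (a + b) * hc
  · linear_combination -ha + a * hb - a * b * hc

theorem qr_disc {Ω : Type*} [Field Ω] (t w a b c d : Ω) (h12 : 12 * w = 1)
    (ht : 27 * t ^ 2 + 8 ≠ 0)
    (h1 : a + b + c + d = 0)
    (h2 : a * b + a * c + a * d + b * c + b * d + c * d = 1)
    (h3 : a * b * c + a * b * d + a * c * d + b * c * d = t) (h4 : a * b * c * d = -w) :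
    a ≠ b := by
  rintro rfl
  apply ht
  have hd : d = -2 * a - c := by linear_combination h1
  subst hd
  have hq : c * (-2 * a - c) = 1 + 3 * a ^ 2 := by linear_combination h2
  have ht' : t = 4 * a ^ 3 + 2 * a := by linear_combination -h3 + 2 * a * hq
  have h36 : 36 * a ^ 4 + 12 * a ^ 2 + 1 = 0 := by
    linear_combination 12 * h4 - 12 * a ^ 2 * hq - h12
  rw [ht']
  linear_combination (12 * a ^ 2 + 8) * h36

theorem qr_inv {Ω : Type*} [Field Ω] (t w a b c d : Ω) (h12 : 12 * w = 1)
    (h1 : a + b + c + d = 0)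
    (h2 : a * b + a * c + a * d + b * c + b * d + c * d = 1)
    (_h3 : a * b * c + a * b * d + a * c * d + b * c * d = t) (h4 : a * b * c * d = -w) :
    ((a - b) * (c - d)) ^ 2 - ((a - b) * (c - d)) * ((a - c) * (b - d))
      + ((a - c) * (b - d)) ^ 2 = 0 := by
  linear_combination (a * b + a * c + a * d + b * c + b * d + c * d + 1) * h2
    - 3 * (a * b * c + a * b * d + a * c * d + b * c * d) * h1 + 12 * h4 - h12

theorem qr_rem (p : ℕ) [Fact p.Prime] (n : ℕ) :
    ∃ x3 x2 x1 x0 : Polynomial (ZMod p), ∀ {Ω : Type} [CommRing Ω]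
      (φ : Polynomial (ZMod p) →+* Ω) (z : Ω),
      z ^ 4 + z ^ 2 - φ Polynomial.X * z - φ (Polynomial.C 12⁻¹) = 0 →
      z ^ n = φ x3 * z ^ 3 + φ x2 * z ^ 2 + φ x1 * z + φ x0 := by
  induction n with
  | zero => exact ⟨0, 0, 0, 1, fun φ z _ => by simp⟩
  | succ n ih =>
    obtain ⟨x3, x2, x1, x0, h⟩ := ih
    refine ⟨x2, x1 - x3, x0 + x3 * Polynomial.X, x3 * Polynomial.C 12⁻¹, fun φ z hz => ?_⟩
    rw [pow_succ, h φ z hz]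
    simp only [map_add, map_sub, map_mul]
    linear_combination φ x3 * hz


theorem qr_consts (p : ℕ) [hp : Fact p.Prime] (hp3 : 3 < p) :
    (2 : ZMod p) ≠ 0 ∧ (12 : Polynomial (ZMod p)) * Polynomial.C 12⁻¹ = 1 := by
  have hc : ∀ q : ℕ, q.Prime → q ≤ 3 → ((q : ℕ) : ZMod p) ≠ 0 := by
    intro q hq hq3 h
    rw [ZMod.natCast_eq_zero_iff] at h
    have := Nat.le_of_dvd hq.pos h
    omega
  have h2 : (2 : ZMod p) ≠ 0 := by simpa using hc 2 Nat.prime_two (by norm_num)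
  have h3 : (3 : ZMod p) ≠ 0 := by simpa using hc 3 Nat.prime_three (by norm_num)
  have h12 : (12 : ZMod p) ≠ 0 := by
    have : (12 : ZMod p) = 2 * 2 * 3 := by norm_num
    rw [this]; exact mul_ne_zero (mul_ne_zero h2 h2) h3
  have hw : (12 : Polynomial (ZMod p)) * Polynomial.C 12⁻¹ = 1 := by
    have : (12 : Polynomial (ZMod p)) = Polynomial.C 12 := (map_ofNat Polynomial.C 12).symm
    rw [this, ← Polynomial.C_mul, mul_inv_cancel₀ h12, Polynomial.C_1]
  exact ⟨h2, hw⟩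

theorem qr_core (p : ℕ) [hp : Fact p.Prime] (hp3 : 3 < p) (Ω : Type) [Field Ω] [IsAlgClosed Ω]
    (φ : Polynomial (ZMod p) →+* Ω) (hφ : ∀ f, φ f = 0 → f = 0)
    (x3 x2 x1 x0 y3 y2 y1 y0 : Polynomial (ZMod p))
    (hx : ∀ z : Ω, z ^ 4 + z ^ 2 - φ Polynomial.X * z - φ (Polynomial.C 12⁻¹) = 0 →
      z ^ (p ^ 2 + 1) = φ x3 * z ^ 3 + φ x2 * z ^ 2 + φ x1 * z + φ x0)
    (hy : ∀ z : Ω, z ^ 4 + z ^ 2 - φ Polynomial.X * z - φ (Polynomial.C 12⁻¹) = 0 →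
      z ^ (p ^ 2) = φ y3 * z ^ 3 + φ y2 * z ^ 2 + φ y1 * z + φ y0) :
    x3 * y2 - x2 * y3 = 0 := by
  obtain ⟨k, hk⟩ := qr_mod p hp.out hp3
  obtain ⟨h2, hw⟩ := qr_consts p hp3
  have h12w : 12 * φ (Polynomial.C 12⁻¹) = 1 := by
    have := congrArg φ hw
    rwa [map_mul, map_ofNat, map_one] at this
  have ht : 27 * φ Polynomial.X ^ 2 + 8 ≠ 0 := by
    intro h
    have h' : φ (27 * Polynomial.X ^ 2 + 8) = 0 := by
      simpa only [map_add, map_mul, map_pow, map_ofNat] using h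
    have h'' := congrArg (Polynomial.coeff · 0) (hφ _ h')
    simp only [Polynomial.coeff_add, Polynomial.coeff_zero, Polynomial.mul_coeff_zero, Polynomial.coeff_X_pow] at h''
    have h88 : (8 : Polynomial (ZMod p)) = Polynomial.C 8 := (map_ofNat Polynomial.C 8).symm
    rw [h88] at h''
    simp only [Polynomial.coeff_C_zero] at h''
    norm_num at h''
    apply h2
    have h8 : (2 : ZMod p) ^ 3 = 0 := by rw [← h'']; norm_num
    exact pow_eq_zero_iff (by norm_num) |>.1 h8
  obtain ⟨a, b, c, d, e1, e2, e3, e4⟩ := qr_roots (φ Polynomial.X) (φ (Polynomial.C 12⁻¹))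
  have hcharΩ : CharP Ω p := charP_of_injective_ringHom (f := φ.comp Polynomial.C)
    (RingHom.injective _) p
  have ra : ∀ z, (z - a) * (z - b) * (z - c) * (z - d) = 0 →
      z ^ 4 + z ^ 2 - φ Polynomial.X * z - φ (Polynomial.C 12⁻¹) = 0 := by
    intro z hz
    linear_combination hz + z ^ 3 * e1 - z ^ 2 * e2 + z * e3 - e4
  have Ra := ra a (by ring)
  have Rb := ra b (by ring)
  have Rc := ra c (by ring)
  have Rd := ra d (by ring)
  have hfrob : ∀ x y : Ω, x ^ p ^ 2 - y ^ p ^ 2 = (x - y) ^ p ^ 2 := fun x y =>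
    (sub_pow_char_pow x y 2).symm
  have hdet := qr_det_one a b c d _ _ _ _ (φ x3) (φ x2) (φ x1) (φ x0) (φ y3) (φ y2) (φ y1) (φ y0)
    (hy a Ra) (hy b Rb) (hy c Rc) (hy d Rd)
    (by rw [← hx a Ra]; ring) (by rw [← hx b Rb]; ring)
    (by rw [← hx c Rc]; ring) (by rw [← hx d Rd]; ring)
  rw [hfrob, hfrob, hfrob, hfrob, ← mul_pow, ← mul_pow, hk,
    ← qr_pow _ _ (qr_inv _ _ a b c d h12w e1 e2 e3 e4) k, sub_self] at hdet
  have nab : a ≠ b := qr_disc _ _ a b c d h12w ht e1 e2 e3 e4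
  have nac : a ≠ c := qr_disc _ _ a c b d h12w ht (by rw [← e1]; ring) (by rw [← e2]; ring)
    (by rw [← e3]; ring) (by rw [← e4]; ring)
  have nad : a ≠ d := qr_disc _ _ a d b c h12w ht (by rw [← e1]; ring) (by rw [← e2]; ring)
    (by rw [← e3]; ring) (by rw [← e4]; ring)
  have nbc : b ≠ c := qr_disc _ _ b c a d h12w ht (by rw [← e1]; ring) (by rw [← e2]; ring)
    (by rw [← e3]; ring) (by rw [← e4]; ring)
  have nbd : b ≠ d := qr_disc _ _ b d a c h12w ht (by rw [← e1]; ring) (by rw [← e2]; ring)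
    (by rw [← e3]; ring) (by rw [← e4]; ring)
  have ncd : c ≠ d := qr_disc _ _ c d a b h12w ht (by rw [← e1]; ring) (by rw [← e2]; ring)
    (by rw [← e3]; ring) (by rw [← e4]; ring)
  have hxy : x3 * y2 - x2 * y3 = 0 := by
    apply hφ
    rw [map_sub, map_mul, map_mul]
    refine (mul_eq_zero.1 hdet).resolve_right ?_
    simp only [mul_ne_zero_iff, sub_ne_zero]
    exact ⟨⟨⟨⟨⟨nab, nac⟩, nad⟩, nbc⟩, nbd⟩, ncd⟩
  exact hxy

theorem qr_main (p : ℕ) [hp : Fact p.Prime] (hp3 : 3 < p) (E : Type) [Field E]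
    (ψ : Polynomial (ZMod p) →+* E) (hinj : ∀ f, ψ f = 0 → f = 0) (α : E)
    (heq : α ^ 4 + α ^ 2 - ψ Polynomial.X * α - (12 : E)⁻¹ = 0) :
    ∃ A B C D : Polynomial (ZMod p),
      ¬(A = 0 ∧ B = 0 ∧ C = 0 ∧ D = 0) ∧
      ψ A * α ^ (p ^ 2 + 1) + ψ B * α ^ (p ^ 2) + ψ C * α + ψ D = 0 := by
  obtain ⟨h2, hw⟩ := qr_consts p hp3
  have hψw : ψ (Polynomial.C 12⁻¹) = (12 : E)⁻¹ := by
    apply eq_inv_of_mul_eq_one_right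
    have := congrArg ψ hw
    rwa [map_mul, map_ofNat, map_one] at this
  have hα : α ^ 4 + α ^ 2 - ψ Polynomial.X * α - ψ (Polynomial.C 12⁻¹) = 0 := by
    rw [hψw]; exact heq
  obtain ⟨x3, x2, x1, x0, hx⟩ := qr_rem p (p ^ 2 + 1)
  obtain ⟨y3, y2, y1, y0, hy⟩ := qr_rem p (p ^ 2)
  have hxy : x3 * y2 - x2 * y3 = 0 :=
    qr_core p hp3 (AlgebraicClosure E) ((algebraMap E (AlgebraicClosure E)).comp ψ)
      (fun f hf => hinj f ((map_eq_zero (algebraMap E (AlgebraicClosure E))).1 hf))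
      x3 x2 x1 x0 y3 y2 y1 y0 (fun z hz => hx _ z hz) (fun z hz => hy _ z hz)
  have X := hx ψ α hα
  have Y := hy ψ α hα
  have hxy' : ψ x3 * ψ y2 - ψ x2 * ψ y3 = 0 := by
    simpa only [map_sub, map_mul, map_zero] using congrArg ψ hxy
  by_cases hcase3 : y3 = 0 ∧ x3 = 0
  · obtain ⟨hy3, hx3⟩ := hcase3
    rw [hx3, map_zero] at X
    rw [hy3, map_zero] at Y
    by_cases hy2 : y2 = 0
    · rw [hy2, map_zero] at Y
      refine ⟨0, 1, -y1, -y0, by simp, ?_⟩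
      rw [Y]; simp
    · refine ⟨y2, -x2, x2 * y1 - y2 * x1, x2 * y0 - y2 * x0, fun h => hy2 h.1, ?_⟩
      rw [X, Y]; simp only [map_sub, map_mul, map_neg]; ring
  · refine ⟨y3, -x3, x3 * y1 - y3 * x1, x3 * y0 - y3 * x0,
      fun h => hcase3 ⟨h.1, neg_eq_zero.1 h.2.1⟩, ?_⟩
    rw [X, Y]; simp only [map_sub, map_mul, map_neg]
    linear_combination -α ^ 2 * hxy'

/-- Let `p > 3` be a prime with `p ≡ 2 (mod 3)` and let `α` be the
unique solution in `F(p)` of positive valuation of `α^4 + α^2 − T·α − 1/12 = 0`.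
Then `α` is hyperquadratic of order 2: there exist `A, B, C, D ∈ F_p[T]`, not all
zero, with `A·α^(p²+1) + B·α^(p²) + C·α + D = 0`. -/
theorem quartic_root_hyperquadratic_order_two
    (p : ℕ) [hp : Fact p.Prime] (hp3 : 3 < p) (hmod : p % 3 = 2)
    (α : LaurentSeries (ZMod p))
    (hval : ∀ n : ℤ, n ≤ 0 → α.coeff n = 0)
    (heq : α ^ 4 + α ^ 2 - HahnSeries.single (-1 : ℤ) (1 : ZMod p) * α
        - (12 : LaurentSeries (ZMod p))⁻¹ = 0) :
    ∃ A B C D : Polynomial (ZMod p),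
      ¬(A = 0 ∧ B = 0 ∧ C = 0 ∧ D = 0) ∧
      Polynomial.aeval (HahnSeries.single (-1 : ℤ) (1 : ZMod p)) A * α ^ (p ^ 2 + 1)
        + Polynomial.aeval (HahnSeries.single (-1 : ℤ) (1 : ZMod p)) B * α ^ (p ^ 2)
        + Polynomial.aeval (HahnSeries.single (-1 : ℤ) (1 : ZMod p)) C * α
        + Polynomial.aeval (HahnSeries.single (-1 : ℤ) (1 : ZMod p)) D = 0 := by
  have key := qr_main p hp3 (LaurentSeries (ZMod p))
    (Polynomial.aeval (R := ZMod p) (HahnSeries.single (-1 : ℤ) (1 : ZMod p))).toRingHom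
    (fun f hf => qr_inj p f hf) α (by
      have hX : (Polynomial.aeval (R := ZMod p)
          (HahnSeries.single (-1 : ℤ) (1 : ZMod p))).toRingHom Polynomial.X =
          HahnSeries.single (-1 : ℤ) (1 : ZMod p) := Polynomial.aeval_X _
      rw [hX]; exact heq)
  exact key
end

section
/- Let p = 13 and let α be the unique solution in F(13) with positive valuation of α^4 + α^2 − Tα + 1 = 0 (note that in F_13 one has −1/12 = 1, so this is the Mills–Robbins quartic). Then α is hyperquadratic of order 1: there exist polynomials A, B, C, D ∈ F_13[T], not all zero, such that A·α^{14} + B·α^{13} + C·α + D = 0. -/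
/-- Let `p = 13` and let `α` be the unique solution in `F(13)` of
positive valuation of the Mills–Robbins quartic `α^4 + α^2 − T·α + 1 = 0`
(note `−1/12 = 1` in `F_13`).  Then `α` is hyperquadratic of order 1: there exist
`A, B, C, D ∈ F_13[T]`, not all zero, with `A·α^14 + B·α^13 + C·α + D = 0`. -/
theorem millsRobbins_quartic_root_hyperquadratic_p13
    (α : LaurentSeries (ZMod 13))
    (hval : ∀ n : ℤ, n ≤ 0 → α.coeff n = 0)
    (heq : α ^ 4 + α ^ 2 - HahnSeries.single (-1 : ℤ) (1 : ZMod 13) * α + 1 = 0) :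
    ∃ A B C D : Polynomial (ZMod 13),
      ¬(A = 0 ∧ B = 0 ∧ C = 0 ∧ D = 0) ∧
      Polynomial.aeval (HahnSeries.single (-1 : ℤ) (1 : ZMod 13)) A * α ^ 14
        + Polynomial.aeval (HahnSeries.single (-1 : ℤ) (1 : ZMod 13)) B * α ^ 13
        + Polynomial.aeval (HahnSeries.single (-1 : ℤ) (1 : ZMod 13)) C * α
        + Polynomial.aeval (HahnSeries.single (-1 : ℤ) (1 : ZMod 13)) D = 0 := by
  have h13 : (13 : LaurentSeries (ZMod 13)) = 0 := by
    have h : ((13 : ZMod 13)) = 0 := by decide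
    have h2 := congrArg (algebraMap (ZMod 13) (LaurentSeries (ZMod 13))) h
    simpa only [map_ofNat, map_zero] using h2
  generalize hT : (HahnSeries.single (-1 : ℤ) (1 : ZMod 13) : LaurentSeries (ZMod 13)) = t at *
  refine ⟨Polynomial.C (4)*Polynomial.X^1, Polynomial.C (1) + Polynomial.C (1)*Polynomial.X^2, Polynomial.C (-1) + Polynomial.C (2)*Polynomial.X^2 + Polynomial.C (-1)*Polynomial.X^4 + Polynomial.C (-1)*Polynomial.X^6, Polynomial.C (2)*Polynomial.X^1 + Polynomial.C (2)*Polynomial.X^3 + Polynomial.C (1)*Polynomial.X^5, ?_, ?_⟩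
  · rintro ⟨hA, hB, hC, hD⟩
    have h := congrArg (Polynomial.eval 0) hB
    simp at h
    exact absurd h (by decide)
  · simp only [map_add, map_mul, map_pow, map_neg, map_zero, map_one, map_ofNat, Polynomial.aeval_X, Polynomial.aeval_C]
    linear_combination ((2)*t^1 + (2)*t^3 + (1)*t^5 + (-1)*α^1 + (4)*α^1*t^2 + (1)*α^1*t^4 + (-3)*α^2*t^1 + (2)*α^2*t^3 + (1)*α^3 + (6)*α^3*t^2 + (1)*α^3*t^4 + (2)*α^4*t^1 + (2)*α^4*t^3 + (5)*α^5*t^2 + (1)*α^6*t^1 + (1)*α^6*t^3 + (-1)*α^7 + (3)*α^7*t^2 + (-4)*α^8*t^1 + (1)*α^9 + (1)*α^9*t^2 + (4)*α^10*t^1) * heq + ((-1)*α^3*t^2 + (-1)*α^5*t^2 + (-1)*α^7*t^2 + (-1)*α^9*t^2) * h13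
end

section
/- Let p = 3 and let α be the unique solution in F(3) with positive valuation of α^4 + α^2 − Tα + 1 = 0. Then α is NOT hyperquadratic: for every integer t ≥ 1, setting r = 3^t, there do not exist polynomials A, B, C, D ∈ F_3[T], not all zero, such that A·α^{r+1} + B·α^{r} + C·α + D = 0. -/
theorem mr_det {K : Type*} [Field K] (x y : Fin 4 → K) (v : Fin 4 → K) (hv : v ≠ 0)
    (h : ∀ i, v 0 * (x i * y i) + v 1 * y i + v 2 * x i + v 3 = 0) :
    (x 0 - x 1) * (x 2 - x 3) * ((y 0 - y 2) * (y 1 - y 3))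
      = (x 0 - x 2) * (x 1 - x 3) * ((y 0 - y 1) * (y 2 - y 3)) := by
  have hd : (Matrix.of fun i : Fin 4 => ![x i * y i, y i, x i, 1]).det = 0 := by
    rw [← Matrix.exists_mulVec_eq_zero_iff]
    refine ⟨v, hv, ?_⟩
    ext i
    simp [Matrix.mulVec, dotProduct, Fin.sum_univ_succ]
    have := h i
    linear_combination this
  simp [Matrix.det_succ_row_zero, Fin.sum_univ_succ, Fin.succAbove] at hd
  linear_combination hd

theorem mr_core {K : Type*} [Field K] [CharP K 3] (t : ℕ) (T : K) (x : Fin 4 → K)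
    (h1 : x 0 + x 1 + x 2 + x 3 = 0)
    (h2 : x 0 * x 1 + x 0 * x 2 + x 0 * x 3 + x 1 * x 2 + x 1 * x 3 + x 2 * x 3 = 1)
    (h3 : x 0 * x 1 * x 2 + x 0 * x 1 * x 3 + x 0 * x 2 * x 3 + x 1 * x 2 * x 3 = T)
    (h4 : x 0 * x 1 * x 2 * x 3 = 1)
    (v : Fin 4 → K) (hv : v ≠ 0)
    (h : ∀ i, v 0 * (x i * x i ^ 3 ^ t) + v 1 * x i ^ 3 ^ t + v 2 * x i + v 3 = 0) :
    T ^ (2 * 3 ^ t) = T ^ 2 := by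
  have c3 : (3 : K) = 0 := by exact_mod_cast CharP.cast_eq_zero K 3
  have hdet := mr_det x (fun i => x i ^ 3 ^ t) v hv h
  have : Fact (Nat.Prime 3) := ⟨by norm_num⟩
  simp only [← sub_pow_char_pow (p := 3), ← mul_pow] at hdet
  obtain ⟨P, hP⟩ : ∃ P, P = (x 0 - x 1) * (x 2 - x 3) := ⟨_, rfl⟩
  obtain ⟨Q, hQ⟩ : ∃ Q, Q = (x 0 - x 2) * (x 1 - x 3) := ⟨_, rfl⟩
  rw [← hP, ← hQ] at hdet
  have hPQ : P + Q = 1 := by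
    rw [hP, hQ]
    linear_combination h2 - c3 * (x 0 * x 3 + x 1 * x 2)
  have hPQ' : P ^ 3 ^ t + Q ^ 3 ^ t = 1 := by
    rw [← add_pow_char_pow (p := 3), hPQ, one_pow]
  have hPP : P ^ 3 ^ t = P := by
    linear_combination -hdet + P * hPQ' - P ^ 3 ^ t * hPQ
  have hQQ : Q ^ 3 ^ t = Q := by linear_combination hPQ' - hPQ - hPP
  have hD : (P * Q * (P - Q)) ^ 2 = - T ^ 2 := by
    have e3 : x 3 = -(x 0 + x 1 + x 2) := by linear_combination h1
    have key : ∀ p q r : K, p = x 0 * x 1 + x 0 * x 2 + x 0 * x 3 + x 1 * x 2 + x 1 * x 3 + x 2 * x 3 →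
        q = x 0 * x 1 * x 2 + x 0 * x 1 * x 3 + x 0 * x 2 * x 3 + x 1 * x 2 * x 3 →
        r = x 0 * x 1 * x 2 * x 3 → 
        (P * Q * (P - Q)) ^ 2 = 16*p^4*r -4*p^3*q^2 -128*p^2*r^2+144*p*q^2*r -27*q^4+256*r^3 := by
      intro p q r hp hq hr
      rw [hp, hq, hr, hP, hQ, e3]
      ring
    rw [key 1 T 1 h2.symm h3.symm h4.symm]
    linear_combination c3 * (48 + 47 * T^2 - 9 * T^4)
  have hF : ((P * Q * (P - Q)) ^ 2) ^ 3 ^ t = (P * Q * (P - Q)) ^ 2 := by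
    rw [← pow_mul, mul_comm 2, pow_mul, mul_pow _ _ (3 ^ t), mul_pow _ _ (3 ^ t), sub_pow_char_pow (p := 3), hPP, hQQ]
  rw [hD, neg_pow, Odd.neg_one_pow (Odd.pow (by decide)), ← pow_mul] at hF
  linear_combination -hF

open Polynomial in
/-- The quartic, as a polynomial over `F_3[T]`. -/
noncomputable def mrF : Polynomial (Polynomial (ZMod 3)) := X ^ 4 + X ^ 2 - C X * X + 1

open Polynomial in
theorem mrF_monic : mrF.Monic := by
  unfold mrF; monicity!

open Polynomial in
theorem mrF_natDegree : mrF.natDegree = 4 := by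
  unfold mrF; compute_degree!

open Polynomial in
theorem mrF_irreducible : Irreducible mrF := by
  have : Fact (Nat.Prime 3) := ⟨by norm_num⟩
  have h : Bivariate.swap mrF = C (-X) * X + C (X ^ 4 + X ^ 2 + 1) := by
    simp only [mrF, map_add, map_sub, map_mul, map_pow, map_one, Bivariate.swap_X,
      Bivariate.swap_Y, map_neg]
    ring
  rw [← MulEquiv.irreducible_iff (Bivariate.swap (R := ZMod 3)), h]
  apply irreducible_C_mul_X_add_C
  · simp
  · apply IsCoprime.isRelPrime
    exact ⟨X ^ 3 + X, 1, by ring⟩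

open Polynomial in
theorem mr_generic {L : Type*} [Field L] [Algebra (ZMod 3)[X] L]
    (hinj : Function.Injective (algebraMap (ZMod 3)[X] L)) (α : L)
    (heq : α ^ 4 + α ^ 2 - algebraMap (ZMod 3)[X] L X * α + 1 = 0) (t : ℕ) (ht : 1 ≤ t)
    (A B C' D : (ZMod 3)[X]) (hne : ¬ (A = 0 ∧ B = 0 ∧ C' = 0 ∧ D = 0))
    (hrel : algebraMap (ZMod 3)[X] L A * α ^ (3 ^ t + 1) + algebraMap (ZMod 3)[X] L B * α ^ (3 ^ t)
      + algebraMap (ZMod 3)[X] L C' * α + algebraMap (ZMod 3)[X] L D = 0) : False := by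
  have : Fact (Nat.Prime 3) := ⟨by norm_num⟩
  have : FaithfulSMul (ZMod 3)[X] L := (faithfulSMul_iff_algebraMap_injective _ _).2 hinj
  have hf0 : aeval α mrF = 0 := by
    simpa [mrF] using heq
  have hint : IsIntegral (ZMod 3)[X] α := ⟨mrF, mrF_monic, by simpa [aeval_def] using hf0⟩
  have hmin : minpoly (ZMod 3)[X] α = mrF := by
    have hd := minpoly.isIntegrallyClosed_dvd hint hf0
    have ha : Associated (minpoly (ZMod 3)[X] α) mrF :=
      (mrF_irreducible.dvd_iff.1 hd).resolve_left (minpoly.not_isUnit _ _) |>.symm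
    exact eq_of_monic_of_associated (minpoly.monic hint) mrF_monic ha
  have hdvd : mrF ∣ C A * X ^ (3 ^ t + 1) + C B * X ^ (3 ^ t) + C C' * X + C D := by
    rw [← hmin]
    apply minpoly.isIntegrallyClosed_dvd hint
    simpa using hrel
  let K := AlgebraicClosure (FractionRing (ZMod 3)[X])
  have hKinj : Function.Injective (algebraMap (ZMod 3)[X] K) := by
    rw [IsScalarTower.algebraMap_eq (ZMod 3)[X] (FractionRing (ZMod 3)[X]) K]
    exact (algebraMap (FractionRing (ZMod 3)[X]) K).injective.comp (IsFractionRing.injective _ _)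
  have : CharP K 3 := charP_of_injective_algebraMap hKinj 3
  set φ := algebraMap (ZMod 3)[X] K with hφ
  have hm : (mrF.map φ).Monic := mrF_monic.map φ
  have hs := IsAlgClosed.splits (mrF.map φ)
  have hprod := hs.eq_prod_roots_of_monic hm
  have hcard : (mrF.map φ).roots.card = 4 := by
    rw [← hs.natDegree_eq_card_roots, mrF_monic.natDegree_map, mrF_natDegree]
  obtain ⟨l, hl⟩ := Quot.exists_rep (mrF.map φ).roots
  change (l : Multiset K) = _ at hl
  rw [← hl] at hprod hcard
  obtain ⟨a, b, c, d, rfl⟩ : ∃ a b c d, l = [a, b, c, d] := by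
    match l, hcard with
    | [a, b, c, d], _ => exact ⟨a, b, c, d, rfl⟩
  have hexp : mrF.map φ = X ^ 4 - C (a + b + c + d) * X ^ 3
      + C (a * b + a * c + a * d + b * c + b * d + c * d) * X ^ 2
      - C (a * b * c + a * b * d + a * c * d + b * c * d) * X + C (a * b * c * d) := by
    rw [hprod]
    simp only [Multiset.map_coe, List.map, Multiset.prod_coe, List.prod_cons, List.prod_nil,
      C_add, C_mul]
    ring
  have hroot : ∀ i : Fin 4, (mrF.map φ).eval (![a, b, c, d] i) = 0 := by
    intro i
    rw [hprod]
    fin_cases i <;> simp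
  have hmap : mrF.map φ = X ^ 4 + X ^ 2 - C (φ X) * X + C 1 := by
    simp [mrF]
  have hco : ∀ n, (mrF.map φ).coeff n = _ := fun n => congrArg (fun p => coeff p n) hexp
  rw [hmap] at hco
  have c0 := hco 0
  have c1 := hco 1
  have c2 := hco 2
  have c3 := hco 3
  simp only [coeff_add, coeff_sub, coeff_C_mul, coeff_X_pow, coeff_X, coeff_C] at c0 c1 c2 c3
  norm_num at c0 c1 c2 c3
  have hfin := mr_core t (φ X) ![a, b, c, d]
    (by simpa using (by linear_combination c3 : a + b + c + d = 0)) (by simpa using c2.symm)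
    (by simpa using (by linear_combination c1 :
      a * b * c + a * b * d + a * c * d + b * c * d = φ X)) (by simpa using c0.symm)
    ![φ A, φ B, φ C', φ D]
    (by
      intro h0
      apply hne
      have e0 := congrFun h0 0
      have e1 := congrFun h0 1
      have e2 := congrFun h0 2
      have e3 := congrFun h0 3
      simp only [Matrix.cons_val, Pi.zero_apply, map_eq_zero_iff φ hKinj] at e0 e1 e2 e3
      exact ⟨e0, e1, e2, e3⟩)
    (by
      intro i
      obtain ⟨q, hq⟩ := hdvd
      have := congrArg (fun p => eval (![a, b, c, d] i) (p.map φ)) hq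
      simp only [Polynomial.map_mul, eval_mul, hroot i, zero_mul] at this
      simp only [Polynomial.map_add, Polynomial.map_mul, Polynomial.map_pow, map_X, map_C,
        eval_add, eval_mul, eval_pow, eval_X, eval_C] at this
      simp only [Matrix.cons_val]
      linear_combination this)
  rw [← map_pow, ← map_pow] at hfin
  have := congrArg natDegree (hKinj hfin)
  rw [natDegree_X_pow, natDegree_X_pow] at this
  have h3 : 1 < 3 ^ t := Nat.one_lt_pow (by omega) (by norm_num)
  omega

open Polynomial in
theorem mr_inj : Function.Injective
    (aeval (R := ZMod 3) (HahnSeries.single (-1 : ℤ) (1 : ZMod 3) : LaurentSeries (ZMod 3))) := by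
  rw [injective_iff_map_eq_zero]
  intro A hA
  ext n
  have h := congrArg (fun s : LaurentSeries (ZMod 3) => s.coeff (-(n : ℤ))) hA
  have hs : ∀ i : ℕ, (HahnSeries.single (-1 : ℤ) (1 : ZMod 3) : LaurentSeries (ZMod 3)) ^ i
      = HahnSeries.single (-(i : ℤ)) 1 := by
    intro i
    rw [HahnSeries.single_pow]
    simp
  have hC : algebraMap (ZMod 3) (LaurentSeries (ZMod 3)) = HahnSeries.C := RingHom.ext_zmod _ _
  simp only [aeval_eq_sum_range, Algebra.smul_def, hC, hs, HahnSeries.coeff_sum,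
    HahnSeries.C_apply, HahnSeries.single_mul_single,
    HahnSeries.coeff_zero, HahnSeries.coeff_single, neg_inj, Nat.cast_inj, zero_add, mul_one] at h
  simp at h
  rw [coeff_zero]
  rcases le_or_gt n A.natDegree with hn | hn
  · exact h hn
  · exact coeff_eq_zero_of_natDegree_lt hn

/-- Let `p = 3` and let `α` be the unique solution in `F(3)` of
positive valuation of `α^4 + α^2 − T·α + 1 = 0`.  Then `α` is NOT hyperquadratic:
for every `t ≥ 1`, with `r = 3^t`, there are no polynomials `A, B, C, D ∈ F_3[T]`,
not all zero, such that `A·α^(r+1) + B·α^r + C·α + D = 0`. -/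
theorem millsRobbins_quartic_root_not_hyperquadratic_p3
    (α : LaurentSeries (ZMod 3))
    (hval : ∀ n : ℤ, n ≤ 0 → α.coeff n = 0)
    (heq : α ^ 4 + α ^ 2 - HahnSeries.single (-1 : ℤ) (1 : ZMod 3) * α + 1 = 0) :
    ∀ t : ℕ, 1 ≤ t →
      ¬ ∃ A B C D : Polynomial (ZMod 3),
        ¬(A = 0 ∧ B = 0 ∧ C = 0 ∧ D = 0) ∧
        Polynomial.aeval (HahnSeries.single (-1 : ℤ) (1 : ZMod 3)) A * α ^ (3 ^ t + 1)
          + Polynomial.aeval (HahnSeries.single (-1 : ℤ) (1 : ZMod 3)) B * α ^ (3 ^ t)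
          + Polynomial.aeval (HahnSeries.single (-1 : ℤ) (1 : ZMod 3)) C * α
          + Polynomial.aeval (HahnSeries.single (-1 : ℤ) (1 : ZMod 3)) D = 0 := by
  rintro t ht ⟨A, B, C, D, hne, hrel⟩
  letI : Fact (Nat.Prime 3) := ⟨by norm_num⟩
  let ψ := Polynomial.aeval (R := ZMod 3)
    (HahnSeries.single (-1 : ℤ) (1 : ZMod 3) : LaurentSeries (ZMod 3))
  refine @mr_generic (LaurentSeries (ZMod 3)) inferInstance ψ.toRingHom.toAlgebra
    mr_inj α ?_ t ht A B C D hne hrel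
  have hX : ψ Polynomial.X = HahnSeries.single (-1 : ℤ) (1 : ZMod 3) := Polynomial.aeval_X _
  change α ^ 4 + α ^ 2 - ψ Polynomial.X * α + 1 = 0
  rw [hX]
  exact heq
end
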